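/- arXiv:2507.13096 — 9 statements merged into one kernel-verified Lean document; each statement's English description precedes it below -/
import Mathlib

section
/- Let G be a finite simple graph, and let F be a source-flip sequence of orientations of G. If a vertex v of G is flipped at step i and next at step j (with no flip of v strictly between i and j), then every neighbor of v in G is flipped exactly once strictly between steps i and j. (This is the combinatorial content of the first assertion of Lemma 5.6 ('following 1') of the paper.) -/
/-- An orientation of a simple graph `G`: each edge of `G` is assigned a direction.
`dir u v = true` means the edge between `u` and `v` is directed from `u` to `v`. -/
structure GraphOrientation {V : Type*} (G : SimpleGraph V) where
  dir : V → V → Bool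
  adj_of_dir : ∀ u v, dir u v = true → G.Adj u v
  rev_dir : ∀ u v, G.Adj u v → dir u v = !dir v u

/-- A vertex is a source of an orientation if every incident edge is directed away from it. -/
def GraphOrientation.IsSource {V : Type*} {G : SimpleGraph V}
    (o : GraphOrientation G) (x : V) : Prop :=
  ∀ v, G.Adj x v → o.dir x v = true

/-- `IsFlipAt o o' x` means `o'` is obtained from `o` by a source-flip at `x`:
`x` is a source of `o`, and `o'` reverses the direction of every edge incident to `x`. -/
def IsFlipAt {V : Type*} [DecidableEq V] {G : SimpleGraph V}
    (o o' : GraphOrientation G) (x : V) : Prop :=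
  o.IsSource x ∧ ∀ u v, o'.dir u v = if u = x ∨ v = x then o.dir v u else o.dir u v

/-- `IsFlipSeq F c n` means `F 0, F 1, …, F n` is a source-flip sequence of orientations,
where for every `i < n` the `i`-th flip is a source-flip at the vertex `c i`. -/
def IsFlipSeq {V : Type*} [DecidableEq V] {G : SimpleGraph V}
    (F : ℕ → GraphOrientation G) (c : ℕ → V) (n : ℕ) : Prop :=
  ∀ i, i < n → IsFlipAt (F i) (F (i + 1)) (c i)


theorem dir_stays {V : Type*} [DecidableEq V] {G : SimpleGraph V}
    {F : ℕ → GraphOrientation G} {c : ℕ → V} {n : ℕ} (hF : IsFlipSeq F c n)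
    {a b : V} (hab : G.Adj a b) (m : ℕ) (hm : (F m).dir a b = true) (p : ℕ) (hmp : m ≤ p)
    (hpn : p ≤ n) (hno : ∀ k, m ≤ k → k < p → c k ≠ a) : (F p).dir a b = true := by
  induction p, hmp using Nat.le_induction with
  | base => exact hm
  | succ p hmp ih =>
    have h := ih (by omega) (fun k h1 h2 => hno k h1 (by omega))
    obtain ⟨hs, hd⟩ := hF p (by omega)
    have hca := hno p hmp (by omega)
    have hcb : c p ≠ b := by
      intro e
      have h1 := hs a (e ▸ hab.symm)
      rw [e] at h1
      have h2 := (F p).rev_dir a b hab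
      simp [h, h1] at h2
    rw [hd, if_neg (by rintro (e | e) <;> [exact hca e.symm; exact hcb e.symm])]
    exact h

theorem dir_after {V : Type*} [DecidableEq V] {G : SimpleGraph V}
    {F : ℕ → GraphOrientation G} {c : ℕ → V} {n : ℕ} (hF : IsFlipSeq F c n)
    {a b : V} (hab : G.Adj a b) (m : ℕ) (hm : m < n) (hc : c m = b) :
    (F (m + 1)).dir a b = true := by
  obtain ⟨hs, hd⟩ := hF m hm
  rw [hd, if_pos (Or.inr hc.symm)]
  subst hc
  exact hs a hab.symm

theorem not_flip_twice {V : Type*} [DecidableEq V] {G : SimpleGraph V}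
    {F : ℕ → GraphOrientation G} {c : ℕ → V} {n : ℕ} (hF : IsFlipSeq F c n)
    {a b : V} (hab : G.Adj a b) (m p : ℕ) (hmp : m < p) (hp : p < n)
    (hc : c m = b) (hc' : c p = b) (hno : ∀ k, m < k → k < p → c k ≠ a) : False := by
  have h := dir_stays hF hab (m + 1) (dir_after hF hab m (by omega) hc) p hmp hp.le
    (fun k h1 h2 => hno k h1 h2)
  have h1 := (hF p hp).1 a (hc' ▸ hab.symm)
  rw [hc'] at h1
  have h2 := (F p).rev_dir a b hab
  simp [h, h1] at h2

/-- In a source-flip sequence, if a vertex `v` is flipped at step `i` and next at step `j`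
(with no flip of `v` strictly in between), then every neighbor of `v` is flipped exactly
once strictly between steps `i` and `j`. -/
theorem following_one {V : Type*} [Fintype V] [DecidableEq V] (G : SimpleGraph V)
    (F : ℕ → GraphOrientation G) (c : ℕ → V) (n : ℕ)
    (hF : IsFlipSeq F c n)
    (v : V) (i j : ℕ) (hij : i < j) (hjn : j < n)
    (hiv : c i = v) (hjv : c j = v)
    (hbetween : ∀ k, i < k → k < j → c k ≠ v)
    (u : V) (hu : G.Adj v u) :
    ∃! k, i < k ∧ k < j ∧ c k = u := by
  have hex : ∃ k, i < k ∧ k < j ∧ c k = u := by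
    by_contra hne
    exact not_flip_twice hF hu.symm i j hij hjn hiv hjv
      (fun k h1 h2 h3 => hne ⟨k, h1, h2, h3⟩)
  obtain ⟨k, h1, h2, h3⟩ := hex
  refine ⟨k, ⟨h1, h2, h3⟩, ?_⟩
  rintro l ⟨g1, g2, g3⟩
  rcases lt_trichotomy l k with h | h | h
  · exact (not_flip_twice hF hu l k h (by omega) g3 h3
      (fun q q1 q2 => hbetween q (by omega) (by omega))).elim
  · exact h
  · exact (not_flip_twice hF hu k l h (by omega) h3 g3
      (fun q q1 q2 => hbetween q (by omega) (by omega))).elim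
end

section
/- Let G be a finite simple graph, and let F be a source-flip sequence of orientations of G. If a vertex v of G is a source of the initial orientation, then no neighbor of v is flipped in F strictly before the first flip of v; in particular, if v is never flipped in F, then no neighbor of v is flipped in F. (This is the combinatorial content of Lemma 5.3 ('source that cannot be flipped') of the paper.) -/
/-- In a source-flip sequence, if `v` is a source of the initial orientation, then no
neighbor of `v` is flipped strictly before the first flip of `v`: every flip of a
neighbor of `v` is preceded by a flip of `v`.  In particular, if `v` is never flipped,
then no neighbor of `v` is flipped. -/
theorem source_that_cannot_be_flipped {V : Type*} [Fintype V] [DecidableEq V]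
    (G : SimpleGraph V)
    (F : ℕ → GraphOrientation G) (c : ℕ → V) (n : ℕ)
    (hF : IsFlipSeq F c n)
    (v : V) (hv : (F 0).IsSource v) :
    ∀ j, j < n → G.Adj v (c j) → ∃ i, i < j ∧ c i = v := by
  intro j hj hadj
  by_contra hne
  push Not at hne
  have key : ∀ i, (F i).IsSource v → i < n → ¬ G.Adj v (c i) := by
    intro i hs hi ha
    have h1 := hs _ ha
    have h2 := (hF i hi).1 v ha.symm
    have h3 := (F i).rev_dir _ _ ha
    simp [h1, h2] at h3
  have hsrc : ∀ i, i ≤ j → (F i).IsSource v := by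
    intro i
    induction i with
    | zero => intro _; exact hv
    | succ k ih =>
      intro hk w hw
      have hs := ih (by omega)
      have hkn : k < n := by omega
      have h1 : v ≠ c k := fun h => hne k (by omega) h.symm
      have h2 : w ≠ c k := by
        rintro rfl
        exact key k hs hkn hw
      rw [(hF k hkn).2 v w, if_neg (by tauto)]
      exact hs w hw
  exact key j (hsrc j le_rfl) hj hadj
end

section
/- Let G be a finite simple graph, and let F be a source-flip sequence of orientations of G. If C is a cycle of G, not reduced to a single vertex, all of whose edges are coherently directed in the initial orientation (i.e., C is a directed cycle of the initial orientation), then no vertex of C is flipped in F. (This is the combinatorial content of Lemma 5.4 ('oriented cycle that cannot be flipped') of the paper.) -/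
theorem source_not_mem_aux {V : Type*} {G : SimpleGraph V}
    (o : GraphOrientation G) (x a : V) (C : G.Walk a a) (hC : C.IsCycle)
    (hdir : ∀ d ∈ C.darts, o.dir d.fst d.snd = true) (hx : o.IsSource x) :
    x ∉ C.support := by
  intro hmem
  have ha : a ∈ C.support.tail := SimpleGraph.Walk.end_mem_tail_support hC.not_nil
  have ht : x ∈ C.support.tail := by
    rcases (SimpleGraph.Walk.mem_support_iff C).1 hmem with h | h
    · rw [h]; exact ha
    · exact h
  rw [← SimpleGraph.Walk.map_snd_darts] at ht
  obtain ⟨d, hd, rfl⟩ := List.mem_map.1 ht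
  have h1 := hdir d hd
  have h2 := hx d.fst d.adj.symm
  have h3 := o.rev_dir _ _ d.adj
  rw [h1, h2] at h3
  simp at h3

/-- In a source-flip sequence, if `C` is a cycle of `G` (not reduced to a single vertex)
that is a directed cycle of the initial orientation (all its edges coherently directed),
then no vertex of `C` is ever flipped. -/
theorem oriented_cycle_that_cannot_be_flipped {V : Type*} [Fintype V] [DecidableEq V]
    (G : SimpleGraph V)
    (F : ℕ → GraphOrientation G) (c : ℕ → V) (n : ℕ)
    (hF : IsFlipSeq F c n)
    (a : V) (C : G.Walk a a) (hC : C.IsCycle)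
    (hdir : ∀ d ∈ C.darts, (F 0).dir d.fst d.snd = true) :
    ∀ i, i < n → c i ∉ C.support := by
  have key : ∀ i, i ≤ n → ∀ d ∈ C.darts, (F i).dir d.fst d.snd = true := by
    intro i
    induction i with
    | zero => intro _; exact hdir
    | succ k ih =>
      intro hk d hd
      have ihk := ih (by omega)
      obtain ⟨hs, hf⟩ := hF k (by omega)
      have hn := source_not_mem_aux (F k) (c k) a C hC ihk hs
      have h1 : d.fst ≠ c k := fun h => hn (h ▸ C.dart_fst_mem_support_of_mem_darts hd)
      have h2 : d.snd ≠ c k := fun h => hn (h ▸ C.dart_snd_mem_support_of_mem_darts hd)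
      rw [hf, if_neg (by tauto)]
      exact ihk d hd
  intro i hi
  exact source_not_mem_aux (F i) (c i) a C hC (key i hi.le) (hF i hi).1
end

section
/- Let G be a finite simple graph, and let F be a source-flip sequence of orientations of G. If v and w are adjacent vertices of G, then the number of flips of v in F and the number of flips of w in F differ by at most 1. -/
theorem flip_aux {V : Type*} [DecidableEq V]
    (G : SimpleGraph V)
    (F : ℕ → GraphOrientation G) (c : ℕ → V) (n : ℕ)
    (hF : IsFlipSeq F c n)
    (v w : V) (hvw : G.Adj v w) :
    ((Finset.range n).filter (fun i => c i = v)).card + ((F n).dir v w).toNat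
      = ((Finset.range n).filter (fun i => c i = w)).card + ((F 0).dir v w).toNat := by
  induction n with
  | zero => simp
  | succ n ih =>
    have ih := ih (fun i hi => hF i (by omega))
    obtain ⟨hs, hd⟩ := hF n (by omega)
    have hne : v ≠ w := hvw.ne
    have hd := hd v w
    have hr := (F n).rev_dir v w hvw
    rw [Finset.range_add_one, Finset.filter_insert, Finset.filter_insert]
    by_cases h1 : c n = v
    · have h2 : c n ≠ w := fun h => hne (h1.symm.trans h)
      have h3 : (F n).dir v w = true := by rw [← h1]; exact hs w (h1 ▸ hvw)
      have h4 : (F n).dir w v = false := by rw [h3] at hr; simpa using hr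
      rw [if_pos (Or.inl h1.symm), h4] at hd
      rw [if_pos h1, if_neg h2, Finset.card_insert_of_notMem (by simp), hd]
      rw [h3] at ih
      simpa using ih
    · by_cases h2 : c n = w
      · have h3 : (F n).dir w v = true := by rw [← h2]; exact hs v (h2 ▸ hvw.symm)
        rw [if_pos (Or.inr h2.symm), h3] at hd
        rw [h3] at hr
        rw [if_neg h1, if_pos h2, Finset.card_insert_of_notMem (by simp), hd]
        rw [hr] at ih
        simp at ih ⊢
        omega
      · rw [if_neg (by rintro (h | h); exacts [h1 h.symm, h2 h.symm])] at hd
        rw [if_neg h1, if_neg h2, hd]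
        exact ih

/-- In a source-flip sequence, the numbers of flips of two adjacent vertices differ
by at most one. -/
theorem flip_counts_of_adjacent {V : Type*} [Fintype V] [DecidableEq V]
    (G : SimpleGraph V)
    (F : ℕ → GraphOrientation G) (c : ℕ → V) (n : ℕ)
    (hF : IsFlipSeq F c n)
    (v w : V) (hvw : G.Adj v w) :
    ((Finset.range n).filter (fun i => c i = v)).card
      ≤ ((Finset.range n).filter (fun i => c i = w)).card + 1 ∧
    ((Finset.range n).filter (fun i => c i = w)).card
      ≤ ((Finset.range n).filter (fun i => c i = v)).card + 1 := by
  have h := flip_aux G F c n hF v w hvw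
  have h1 := Bool.toNat_le ((F n).dir v w)
  have h2 := Bool.toNat_le ((F 0).dir v w)
  omega
end

section
/- Let G be a connected finite simple graph with q vertices, let r be a vertex of G, and let F be a source-flip sequence of orientations of G that never flips r. Then every vertex v of G is flipped at most d(v,r) times in F, where d denotes the graph distance in G; consequently, F contains at most q(q-1) flips. (This is Lemma 5.8 ('not flipping the root') of the paper, with the O(q^2) bound made explicit.) -/
theorem flip_inv {V : Type*} [DecidableEq V] (G : SimpleGraph V)
    (F : ℕ → GraphOrientation G) (c : ℕ → V) (n : ℕ)
    (hF : IsFlipSeq F c n) (u v : V) (huv : G.Adj u v) (k : ℕ) (hk : k ≤ n) :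
    ((Finset.range k).filter (fun i => c i = u)).card + ((F k).dir u v).toNat
      = ((Finset.range k).filter (fun i => c i = v)).card + ((F 0).dir u v).toNat := by
  induction k with
  | zero => simp
  | succ k ih =>
    have ih := ih (by omega)
    obtain ⟨hs, hf⟩ := hF k (by omega)
    have hne := huv.ne
    have hrev := (F k).rev_dir u v huv
    have hfu := hf u v
    rw [Finset.range_add_one, Finset.filter_insert, Finset.filter_insert]
    by_cases h1 : c k = u
    · have h2 : c k ≠ v := fun h => hne (h1.symm.trans h)
      have h3 := hs v (h1 ▸ huv)
      rw [h1] at h3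
      rw [if_pos h1.symm.symm, if_neg h2, Finset.card_insert_of_notMem (by simp)]
      rw [if_pos (Or.inl h1.symm)] at hfu
      rw [hfu]
      rw [h3] at hrev ih
      have h4 : (F k).dir v u = false := by simpa using hrev.symm
      rw [h4]
      simp at ih ⊢
      omega
    · by_cases h2 : c k = v
      · have h3 := hs u (h2 ▸ huv.symm)
        rw [h2] at h3
        rw [if_neg h1, if_pos h2, Finset.card_insert_of_notMem (by simp)]
        rw [if_pos (Or.inr h2.symm)] at hfu
        rw [hfu, h3]
        rw [h3] at hrev
        rw [hrev] at ih
        simp at ih ⊢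
        omega
      · rw [if_neg h1, if_neg h2]
        rw [if_neg (by rintro (h | h) <;> [exact h1 h.symm; exact h2 h.symm])] at hfu
        rw [hfu]
        exact ih

/-- If a source-flip sequence on a connected finite simple graph `G` with `q` vertices
never flips a vertex `r`, then every vertex `v` is flipped at most `d(v, r)` times,
and consequently the sequence contains at most `q * (q - 1)` flips. -/
theorem not_flipping_the_root {V : Type*} [Fintype V] [DecidableEq V]
    (G : SimpleGraph V) (hG : G.Connected)
    (F : ℕ → GraphOrientation G) (c : ℕ → V) (n : ℕ)
    (hF : IsFlipSeq F c n)
    (r : V) (hr : ∀ i, i < n → c i ≠ r) :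
    (∀ v : V, ((Finset.range n).filter (fun i => c i = v)).card ≤ G.dist v r) ∧
    n ≤ Fintype.card V * (Fintype.card V - 1) := by
  have key : ∀ (u v : V) (p : G.Walk u v),
      ((Finset.range n).filter (fun i => c i = u)).card
        ≤ ((Finset.range n).filter (fun i => c i = v)).card + p.length := by
    intro u v p
    induction p with
    | nil => simp
    | @cons a b _ h p ih =>
      have h1 := flip_inv G F c n hF _ _ h n le_rfl
      have h2 := Bool.toNat_le ((F 0).dir a b)
      rw [SimpleGraph.Walk.length_cons]
      exact le_trans (le_trans (Nat.le_add_right _ _) h1.le)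
        (le_trans (Nat.add_le_add ih h2) (by omega))
  have hr0 : ((Finset.range n).filter (fun i => c i = r)).card = 0 := by
    rw [Finset.card_eq_zero, Finset.filter_eq_empty_iff]
    intro i hi
    exact hr i (Finset.mem_range.mp hi)
  have main : ∀ v : V, ((Finset.range n).filter (fun i => c i = v)).card ≤ G.dist v r := by
    intro v
    obtain ⟨p, hp⟩ := hG.exists_walk_length_eq_dist v r
    have := key v r p
    omega
  refine ⟨main, ?_⟩
  have hd : ∀ v : V, G.dist v r ≤ Fintype.card V - 1 := by
    intro v
    obtain ⟨p, hp, hl⟩ := hG.exists_path_of_dist v r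
    have := hp.length_lt
    omega
  calc n = (Finset.range n).card := (Finset.card_range n).symm
    _ = ∑ v : V, ((Finset.range n).filter (fun i => c i = v)).card :=
        Finset.card_eq_sum_card_fiberwise (fun _ _ => Finset.mem_univ _)
    _ ≤ ∑ _v : V, (Fintype.card V - 1) :=
        Finset.sum_le_sum (fun v _ => (main v).trans (hd v))
    _ = Fintype.card V * (Fintype.card V - 1) := by simp
end

section
/- Let G be a finite simple graph with vertices ordered v_0, v_1, …, v_{q-1}, and let O be an orientation of G that is monotonic with respect to this ordering (every edge is directed from its earlier endpoint to its later endpoint). Then flipping v_0, then v_1, …, then v_{q-1}, in this order, is a valid source-flip sequence starting from O: when it is flipped, each v_i is a source of the current orientation; moreover, the orientation obtained after all q flips equals the initial orientation O. (This is the claim established in Step 2 of the proof of Theorem 1.2 of the paper.) -/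
/-- If an orientation `O` of `G` is monotonic with respect to an ordering
`v_0, …, v_{q-1}` of the vertices (every edge is directed from its earlier endpoint
to its later endpoint), then flipping `v_0`, then `v_1`, …, then `v_{q-1}`, in this
order, is a valid source-flip sequence starting from `O` (each `v_i` is a source of the
current orientation when it is flipped), and the orientation obtained after all `q`
flips equals the initial orientation `O`. -/
theorem monotonic_round_of_flips {V : Type*} [DecidableEq V] (G : SimpleGraph V)
    (q : ℕ) (e : Fin q ≃ V) (O : GraphOrientation G)
    (hmono : ∀ i j : Fin q, G.Adj (e i) (e j) → (O.dir (e i) (e j) = true ↔ i < j)) :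
    ∃ F : ℕ → GraphOrientation G,
      F 0 = O ∧ F q = O ∧
      ∀ i : Fin q, IsFlipAt (F i.val) (F (i.val + 1)) (e i) := by
  have hm : ∀ u v : V, G.Adj u v → (O.dir u v = true ↔ (e.symm u).val < (e.symm v).val) := by
    intro u v h
    have := hmono (e.symm u) (e.symm v) (by simpa using h)
    simpa using this
  let F : ℕ → GraphOrientation G := fun k =>
    { dir := fun u v =>
        if ((e.symm u).val < k ↔ (e.symm v).val < k) then O.dir u v else O.dir v u
      adj_of_dir := by
        intro u v h
        split_ifs at h
        · exact O.adj_of_dir u v h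
        · exact (O.adj_of_dir v u h).symm
      rev_dir := by
        intro u v h
        have h1 := O.rev_dir u v h
        have h2 := O.rev_dir v u h.symm
        by_cases hu : (e.symm u).val < k <;> by_cases hv : (e.symm v).val < k <;>
          simp only [hu, hv, iff_true, true_iff, if_true, not_true, if_false, iff_self] <;>
          assumption }
  have ext' : ∀ o o' : GraphOrientation G, o.dir = o'.dir → o = o' := by
    rintro ⟨d, _, _⟩ ⟨d', _, _⟩ h
    cases h
    rfl
  refine ⟨F, ?_, ?_, ?_⟩
  · apply ext'
    funext u v
    simp [F]
  · apply ext'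
    funext u v
    simp [F]
  · intro i
    refine ⟨?_, ?_⟩
    · intro v h
      have h1 := hm _ _ h
      have h2 := hm _ _ h.symm
      have hne : (e.symm (e i)).val ≠ (e.symm v).val := by
        intro hh
        exact h.ne (e.symm.injective (Fin.ext hh))
      simp only [Equiv.symm_apply_apply] at h1 h2 hne
      simp only [F, Equiv.symm_apply_apply, lt_irrefl, false_iff]
      split_ifs with hc
      · first | exact h1.2 (by omega) | exact h2.2 (by omega)
      · first | exact h1.2 (by omega) | exact h2.2 (by omega)
    · intro u v
      have hu : u = e i ↔ (e.symm u).val = i.val := by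
        rw [← Fin.ext_iff, Equiv.symm_apply_eq]
      have hv : v = e i ↔ (e.symm v).val = i.val := by
        rw [← Fin.ext_iff, Equiv.symm_apply_eq]
      by_cases huv : u = v
      · subst huv
        simp [F]
      · have hne : (e.symm u).val ≠ (e.symm v).val := by
          intro hh
          exact huv (e.symm.injective (Fin.ext hh))
        simp only [F, hu, hv]
        split_ifs <;> first | rfl | (exfalso; omega)
end

section
/- Let D be a finite digraph. If D has no directed cycle and has exactly one source, then there exists an ordering of the vertices of D that is both proper and monotonic. (This is Lemma 5.10 ('construct ordering') of the paper, without the algorithmic complexity claim.) -/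
/-- Lemma 5.10 ('construct ordering'): a finite digraph (a finite simple graph `G` with
an orientation `O`) with no directed cycle and exactly one source (a vertex with no
incoming edge) admits an ordering of its vertices that is both proper and monotonic.

The ordering is given by an equivalence `e : Fin (card V) ≃ V`.  Monotonic: every edge
is directed from its earlier endpoint to its later endpoint.  Proper: (1) every vertex
other than `e 0` is adjacent to an earlier vertex, and (2) the set of indices of
lowpoints (vertices all of whose neighbors, except possibly `e 0`, occur later) is
`{0, …, k}` for some `k`. -/
theorem construct_ordering {V : Type*} [Fintype V] [DecidableEq V]
    (G : SimpleGraph V) (O : GraphOrientation G)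
    (hacyc : ∀ x : V, ¬ Relation.TransGen (fun u v => O.dir u v = true) x x)
    (hsrc : ∃! x : V, ∀ u : V, O.dir u x = false) :
    ∃ (h0 : 0 < Fintype.card V) (e : Fin (Fintype.card V) ≃ V),
      (∀ i j : Fin (Fintype.card V), O.dir (e i) (e j) = true → i < j) ∧
      (∀ i : Fin (Fintype.card V), i ≠ ⟨0, h0⟩ →
        ∃ j : Fin (Fintype.card V), j < i ∧ G.Adj (e i) (e j)) ∧
      (∃ k : ℕ, ∀ i : Fin (Fintype.card V),
        ((∀ j : Fin (Fintype.card V), G.Adj (e i) (e j) → j = ⟨0, h0⟩ ∨ i < j)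
          ↔ (i : ℕ) ≤ k)) := by
  classical
  obtain ⟨s, hs, huniq⟩ := hsrc
  have h0 : 0 < Fintype.card V := Fintype.card_pos_iff.mpr ⟨s⟩
  let A : V → Finset V := fun v =>
    Finset.univ.filter (fun u => Relation.TransGen (fun u v => O.dir u v = true) u v)
  let P : V → Prop := fun v => ∀ u, O.dir u v = true → u = s
  obtain ⟨f, hf⟩ : ∃ f : V → ℕ, ∀ v, f v = if v = s then 0 else if P v then 1 else 2 + (A v).card :=
    ⟨_, fun _ => rfl⟩
  have hPs : P s := fun u hu => by simp [hs u] at hu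
  have hf0 : ∀ v, f v = 0 → v = s := by
    intro v hv
    by_contra hne
    rw [hf, if_neg hne] at hv
    split_ifs at hv
    omega
  have hfs : f s = 0 := by rw [hf, if_pos rfl]
  have hf1 : ∀ v, f v ≤ 1 ↔ P v := by
    intro v
    rw [hf]
    by_cases h1 : v = s
    · subst h1; simp [hPs]
    · by_cases h2 : P v
      · simp [h1, h2]
      · simp only [h1, h2, if_false, iff_false]; omega
  have hmono : ∀ u v, O.dir u v = true → f u < f v := by
    intro u v huv
    have hvs : v ≠ s := by
      rintro rfl
      simp [hs u] at huv
    by_cases hv : P v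
    · have := hv u huv
      subst this
      rw [hfs]
      exact Nat.pos_of_ne_zero fun h => hvs (hf0 v h)
    · by_cases hu : P u
      · have h1 := (hf1 u).2 hu
        have h2 : ¬ f v ≤ 1 := fun h => hv ((hf1 v).1 h)
        omega
      · have hus : u ≠ s := by
          rintro rfl
          exact hu hPs
        rw [hf u, hf v, if_neg hus, if_neg hvs, if_neg hu, if_neg hv]
        have : (A u).card < (A v).card := by
          apply Finset.card_lt_card
          rw [Finset.ssubset_iff_of_subset]
          · refine ⟨u, ?_, ?_⟩
            · simp only [A, Finset.mem_filter, Finset.mem_univ, true_and]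
              exact Relation.TransGen.single (r := fun u v => O.dir u v = true) huv
            · simpa [A] using hacyc u
          · intro w hw
            simp only [A, Finset.mem_filter, Finset.mem_univ, true_and] at hw ⊢
            exact hw.tail huv
        omega
  let e0 := (Fintype.equivFin V).symm
  obtain ⟨e, he⟩ : ∃ e : Fin (Fintype.card V) ≃ V, Monotone (f ∘ e) :=
    ⟨(Tuple.sort (f ∘ e0)).trans e0, Tuple.monotone_sort (f ∘ e0)⟩
  have hlt : ∀ i j, f (e i) < f (e j) → i < j := by
    intro i j h
    by_contra hn
    have : f (e j) ≤ f (e i) := he (not_lt.mp hn)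
    omega
  have he0 : e ⟨0, h0⟩ = s := by
    apply hf0
    have h : f (e ⟨0, h0⟩) ≤ f (e (e.symm s)) :=
      he (Fin.le_def.mpr (Nat.zero_le _))
    rw [e.apply_symm_apply, hfs] at h
    omega
  refine ⟨h0, e, fun i j h => hlt i j (hmono _ _ h), ?_, ?_⟩
  · intro i hi
    have hne : e i ≠ s := fun h => hi (e.injective (h.trans he0.symm))
    have : ¬ ∀ u, O.dir u (e i) = false := fun h => hne (huniq _ h)
    push Not at this
    obtain ⟨u, hu⟩ := this
    have hu : O.dir u (e i) = true := by simpa using hu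
    refine ⟨e.symm u, hlt _ _ ?_, ?_⟩
    · rw [e.apply_symm_apply]; exact hmono _ _ hu
    · rw [e.apply_symm_apply]; exact (O.adj_of_dir _ _ hu).symm
  · obtain ⟨m, hm, hmax⟩ := Finset.exists_max_image
      (Finset.univ.filter (fun i => f (e i) ≤ 1)) id
      ⟨⟨0, h0⟩, by simp [he0, hfs]⟩
    simp only [Finset.mem_filter, Finset.mem_univ, true_and, id] at hm hmax
    refine ⟨m, fun i => ?_⟩
    have key : f (e i) ≤ 1 ↔ (i : ℕ) ≤ m :=
      ⟨fun h => hmax i h, fun h => le_trans (he (Fin.le_def.mpr h)) hm⟩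
    rw [← key, hf1]
    constructor
    · intro h u hu
      have hj := h (e.symm u) (by
        rw [e.apply_symm_apply]; exact (O.adj_of_dir _ _ hu).symm)
      rcases hj with hj | hj
      · rw [← he0, ← hj, e.apply_symm_apply]
      · have h2 := hlt (e.symm u) i (by rw [e.apply_symm_apply]; exact hmono _ _ hu)
        exact absurd hj (lt_asymm h2)
    · intro h j hadj
      by_cases hd : O.dir (e i) (e j) = true
      · exact Or.inr (hlt _ _ (hmono _ _ hd))
      · left
        have hr := O.rev_dir _ _ hadj
        have : O.dir (e j) (e i) = true := by
          revert hr hd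
          cases O.dir (e i) (e j) <;> cases O.dir (e j) (e i) <;> simp
        exact e.injective ((h _ this).trans he0.symm)
end

section
/- Let f : G → M be a graph homomorphism between finite simple graphs. If G is connected, f is contractible, and no vertex of G is a spur of f, then G consists of a single vertex. (This is Lemma 4.2 of the paper, stated for homomorphisms of simple graphs, to which the paper reduces by contracting clusters.) -/
/-- A vertex `v` is a spur of a graph homomorphism `f : G →g M` if `v` has at least one
neighbor in `G` and `f` maps all neighbors of `v` to one single vertex of `M`. -/
def IsSpur {V U : Type*} {G : SimpleGraph V} {M : SimpleGraph U}
    (f : G →g M) (v : V) : Prop :=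
  (∃ u, G.Adj v u) ∧ ∃ m : U, ∀ u, G.Adj v u → f u = m

/-- A walk in `M` (encoded as its list of vertices) has a backtrack if at some point it
traverses an edge and immediately traverses the same edge back, i.e. it contains three
consecutive vertices of the form `a, b, a`. -/
def HasBacktrack {U : Type*} (L : List U) : Prop :=
  ∃ (l₁ l₂ : List U) (a b : U), L = l₁ ++ a :: b :: a :: l₂

/-- One backtrack deletion on walks of `M` (encoded as lists of vertices): remove two
consecutive steps that traverse an edge `a b` of `M` and then traverse it back. -/
def BacktrackStep {U : Type*} (M : SimpleGraph U) (L L' : List U) : Prop :=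
  ∃ (l₁ l₂ : List U) (a b : U), M.Adj a b ∧
    L = l₁ ++ a :: b :: a :: l₂ ∧ L' = l₁ ++ a :: l₂

/-- A closed walk in `M` (encoded as its list of vertices) is contractible if it can be
transformed into a length-zero walk (a single vertex) by a finite sequence of deletions
and insertions of backtracks. -/
def ContractibleWalk {U : Type*} (M : SimpleGraph U) (L : List U) : Prop :=
  ∃ x : U, Relation.EqvGen (BacktrackStep M) L [x]

/-- A graph homomorphism `f : G →g M` is contractible if the image of every closed walk
of `G` is a contractible closed walk of `M`. -/
def ContractibleHom {V U : Type*} (G : SimpleGraph V) (M : SimpleGraph U)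
    (f : G →g M) : Prop :=
  ∀ L : List V, L ≠ [] → L.Chain' G.Adj → L.head? = L.getLast? →
    ContractibleWalk M (L.map f)


section Helpers

open Classical in
noncomputable def pushR {U : Type*} (a : U) : List U → List U
  | [] => [a]
  | [b] => [a, b]
  | b :: c :: l => if a = c then c :: l else a :: b :: c :: l

noncomputable def redR {U : Type*} : List U → List U
  | [] => []
  | a :: l => pushR a (redR l)

def Rdc {U : Type*} : List U → Prop
  | [] => True
  | [_] => True
  | [_, _] => True
  | a :: b :: c :: l => a ≠ c ∧ Rdc (b :: c :: l)

theorem rdc_tail {U : Type*} (a : U) (l : List U) (h : Rdc (a :: l)) : Rdc l := by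
  match l, h with
  | [], _ => trivial
  | [_], _ => trivial
  | _ :: _ :: _, h => exact h.2

theorem pushR_rdc {U : Type*} (a : U) (l : List U) (h : Rdc l) : Rdc (pushR a l) := by
  match l, h with
  | [], _ => trivial
  | [_], _ => trivial
  | b :: c :: l, h =>
    simp only [pushR]
    split_ifs with e
    · exact rdc_tail _ _ h
    · exact ⟨e, h⟩

theorem pushR_head {U : Type*} (a : U) (l : List U) : ∃ t, pushR a l = a :: t := by
  match l with
  | [] => exact ⟨_, rfl⟩
  | [_] => exact ⟨_, rfl⟩
  | b :: c :: l =>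
    simp only [pushR]
    split_ifs with e
    · exact ⟨l, by rw [e]⟩
    · exact ⟨_, rfl⟩

theorem redR_rdc {U : Type*} (l : List U) : Rdc (redR l) := by
  induction l with
  | nil => trivial
  | cons a l ih => exact pushR_rdc a _ ih

theorem pushR_of_rdc {U : Type*} (a : U) (l : List U) (h : Rdc (a :: l)) :
    pushR a l = a :: l := by
  match l, h with
  | [], _ => rfl
  | [_], _ => rfl
  | b :: c :: l, h => simp [pushR, h.1]

theorem redR_of_rdc {U : Type*} (l : List U) (h : Rdc l) : redR l = l := by
  induction l with
  | nil => rfl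
  | cons a l ih =>
    unfold redR
    rw [ih (rdc_tail _ _ h), pushR_of_rdc _ _ h]

theorem pushR_pushR {U : Type*} (a b : U) (t : List U) (h : Rdc (a :: t)) :
    pushR a (pushR b (a :: t)) = a :: t := by
  match t, h with
  | [], _ => simp [pushR]
  | c :: t, h =>
    by_cases e : b = c
    · subst e
      have : pushR b (a :: b :: t) = b :: t := by simp [pushR]
      rw [this, pushR_of_rdc _ _ h]
    · have : pushR b (a :: c :: t) = b :: a :: c :: t := by simp [pushR, e]
      rw [this]; simp [pushR]

theorem redR_step {U : Type*} (a b : U) (l₁ l₂ : List U) :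
    redR (l₁ ++ a :: b :: a :: l₂) = redR (l₁ ++ a :: l₂) := by
  induction l₁ with
  | nil =>
    obtain ⟨t, ht⟩ := pushR_head a (redR l₂)
    have hr := redR_rdc (a :: l₂)
    simp only [redR, List.nil_append] at hr ⊢
    rw [ht] at hr ⊢
    exact pushR_pushR a b t hr
  | cons c l ih => simp only [List.cons_append, redR, ih]

theorem redR_eqv {U : Type*} (M : SimpleGraph U) (L L' : List U)
    (h : Relation.EqvGen (BacktrackStep M) L L') : redR L = redR L' := by
  induction h with
  | rel x y h =>
    obtain ⟨l₁, l₂, a, b, -, rfl, rfl⟩ := h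
    exact redR_step a b l₁ l₂
  | refl => rfl
  | symm _ _ _ ih => exact ih.symm
  | trans _ _ _ _ _ ih1 ih2 => exact ih1.trans ih2

def segR {V : Type*} (w : ℕ → V) : ℕ → ℕ → List V
  | i, 0 => [w i]
  | i, n + 1 => w i :: segR w (i + 1) n

theorem segR_head {V : Type*} (w : ℕ → V) (i n : ℕ) : (segR w i n).head? = some (w i) := by
  cases n <;> rfl

theorem segR_last {V : Type*} (w : ℕ → V) (n : ℕ) :
    ∀ i, (segR w i n).getLast? = some (w (i + n)) := by
  induction n with
  | zero => intro i; rfl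
  | succ n ih =>
    intro i
    have := ih (i + 1)
    simp only [segR, List.getLast?_cons, this]
    simp [Nat.add_assoc, Nat.add_comm 1 n]

theorem segR_chain {V : Type*} (r : V → V → Prop) (w : ℕ → V) (h : ∀ i, r (w i) (w (i + 1)))
    (n : ℕ) : ∀ i, (segR w i n).IsChain r := by
  induction n with
  | zero => intro i; simp [segR]
  | succ n ih =>
    intro i
    rw [segR, List.isChain_cons]
    refine ⟨?_, ih _⟩
    intro y hy
    rw [segR_head] at hy
    cases hy
    exact h i

theorem segR_rdc {V U : Type*} (f : V → U) (w : ℕ → V) (h : ∀ i, f (w i) ≠ f (w (i + 2)))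
    (n : ℕ) : ∀ i, Rdc ((segR w i n).map f) := by
  induction n with
  | zero => intro i; trivial
  | succ n ih =>
    intro i
    match n, ih with
    | 0, _ => trivial
    | 1, _ => exact ⟨h i, trivial⟩
    | n + 2, ih => exact ⟨h i, ih (i + 1)⟩

end Helpers

/-- Lemma 4.2: if `f : G →g M` is a contractible graph homomorphism between finite
simple graphs, `G` is connected, and no vertex of `G` is a spur of `f`, then `G`
consists of a single vertex. -/
theorem contractible_spur_free_hom_is_trivial {V U : Type*}
    [Fintype V] [Fintype U]
    (G : SimpleGraph V) (M : SimpleGraph U) (f : G →g M)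
    (hconn : G.Connected)
    (hcontr : ContractibleHom G M f)
    (hnospur : ∀ v : V, ¬ IsSpur f v) :
    Fintype.card V = 1 := by
  classical
  by_contra hcard
  have hne : Nonempty V := hconn.nonempty
  have hnt : Nontrivial V := by
    rw [← Fintype.one_lt_card_iff_nontrivial]
    have := Fintype.card_pos (α := V)
    omega
  obtain ⟨x, y, hxy⟩ := exists_pair_ne V
  obtain ⟨p⟩ := hconn.preconnected x y
  have hadj : ∃ u v, G.Adj u v := by
    cases p with
    | nil => exact absurd rfl hxy
    | cons h _ => exact ⟨_, _, h⟩
  obtain ⟨u₀, v₀, h₀⟩ := hadj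
  have hstep : ∀ d : {d : V × V // G.Adj d.1 d.2}, ∃ w, G.Adj d.1.2 w ∧ f d.1.1 ≠ f w := by
    intro d
    by_contra hc
    push Not at hc
    exact hnospur d.1.2 ⟨⟨d.1.1, d.2.symm⟩, f d.1.1, fun u hu => (hc u hu).symm⟩
  choose nx hnx1 hnx2 using hstep
  let s : ℕ → {d : V × V // G.Adj d.1 d.2} := fun n =>
    Nat.rec ⟨(u₀, v₀), h₀⟩ (fun _ d => ⟨(d.1.2, nx d), hnx1 d⟩) n
  let w : ℕ → V := fun n => (s n).1.1
  have hw1 : ∀ i, G.Adj (w i) (w (i + 1)) := fun i => (s i).2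
  have hw2 : ∀ i, f (w i) ≠ f (w (i + 2)) := fun i => hnx2 (s i)
  obtain ⟨i, j, hij, hwe⟩ : ∃ i j, i < j ∧ w i = w j := by
    obtain ⟨i, j, hne, he⟩ := Finite.exists_ne_map_eq_of_infinite w
    rcases lt_or_gt_of_ne hne with h | h
    · exact ⟨i, j, h, he⟩
    · exact ⟨j, i, h, he.symm⟩
  obtain ⟨k, rfl⟩ := Nat.exists_eq_add_of_lt hij
  obtain ⟨z, hz⟩ := hcontr (segR w i (k + 1)) (by simp [segR]) (segR_chain _ w hw1 _ _)
    (by rw [segR_head, segR_last, hwe, Nat.add_assoc])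
  have := redR_eqv M _ _ hz
  rw [redR_of_rdc _ (segR_rdc f w hw2 _ _), redR_of_rdc [z] trivial] at this
  have hl := congrArg List.length this
  cases k <;> simp [segR] at hl
end

section
/- Let f : G → M be a graph homomorphism between finite simple graphs. If G is connected, G contains at least one edge, and no vertex of G is a spur of f, then there exists a closed walk of positive length in G whose image walk under f has no backtrack. (This is the key intermediate claim in the proof of Lemma 4.2 of the paper: a spur-free homomorphism admits a nontrivial closed walk with canonical, hence non-contractible, image.) -/
/-- Key claim in the proof of Lemma 4.2: if `f : G →g M` is a graph homomorphism
between finite simple graphs, `G` is connected and contains at least one edge, and no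
vertex of `G` is a spur of `f`, then there exists a closed walk of positive length in
`G` whose image walk under `f` has no backtrack. -/
theorem spur_free_hom_has_canonical_closed_walk {V U : Type*}
    [Fintype V] [Fintype U]
    (G : SimpleGraph V) (M : SimpleGraph U) (f : G →g M)
    (hconn : G.Connected)
    (hedge : ∃ u v : V, G.Adj u v)
    (hnospur : ∀ v : V, ¬ IsSpur f v) :
    ∃ L : List V, 2 ≤ L.length ∧ L.Chain' G.Adj ∧ L.head? = L.getLast? ∧
      ¬ HasBacktrack (L.map f) := by
  classical
  have step : ∀ p : {p : V × V // G.Adj p.1 p.2}, ∃ x : V, G.Adj p.1.2 x ∧ f x ≠ f p.1.1 := by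
    rintro ⟨⟨u, v⟩, h⟩
    by_contra hc
    push Not at hc
    exact hnospur v ⟨⟨u, h.symm⟩, f u, fun x hx => hc x hx⟩
  choose g hg hgf using step
  obtain ⟨u₀, v₀, h₀⟩ := hedge
  let T : {p : V × V // G.Adj p.1 p.2} → {p : V × V // G.Adj p.1 p.2} :=
    fun p => ⟨(p.1.2, g p), hg p⟩
  let s : ℕ → {p : V × V // G.Adj p.1 p.2} := fun n => T^[n] ⟨(u₀, v₀), h₀⟩
  have hs : ∀ n, s (n + 1) = T (s n) := fun n => Function.iterate_succ_apply' T n _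
  let w : ℕ → V := fun n => (s n).1.1
  have hw1 : ∀ n, w (n + 1) = (s n).1.2 := fun n => by
    change (s (n + 1)).1.1 = _
    rw [hs]
  have hw2 : ∀ n, w (n + 2) = g (s n) := fun n => by
    rw [hw1 (n + 1), hs]
  have hadj : ∀ n, G.Adj (w n) (w (n + 1)) := fun n => by
    rw [hw1]; exact (s n).2
  have hne : ∀ n, f (w (n + 2)) ≠ f (w n) := fun n => by
    rw [hw2]; exact hgf (s n)
  obtain ⟨i, j, hij, hwij⟩ : ∃ i j, i < j ∧ w i = w j := by
    obtain ⟨i, j, h, h'⟩ := Finite.exists_ne_map_eq_of_infinite w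
    rcases lt_or_gt_of_ne h with h1 | h1
    · exact ⟨i, j, h1, h'⟩
    · exact ⟨j, i, h1, h'.symm⟩
  obtain ⟨k, rfl⟩ : ∃ k, j = i + (k + 1) := ⟨j - i - 1, by omega⟩
  refine ⟨(List.range (k + 2)).map (fun n => w (i + n)), by simp, ?_, ?_, ?_⟩
  · refine List.isChain_iff_getElem.mpr ?_
    intro n hn
    simpa [add_assoc] using hadj (i + n)
  · simp [List.head?_range, List.getLast?_range, hwij]
  · rintro ⟨l₁, l₂, a, b, h⟩
    have e1 := congrArg (fun l => l[l₁.length]?) h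
    have e2 := congrArg (fun l => l[l₁.length + 2]?) h
    have hl := congrArg List.length h
    simp at hl
    have b1 : l₁.length < k + 2 := by omega
    have b2 : l₁.length + 2 < k + 2 := by omega
    simp [List.getElem?_range, b1] at e1
    simp [List.getElem?_range, show l₁.length < k by omega] at e2
    apply hne (i + l₁.length)
    rw [e1, ← e2]
    rfl
end
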